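/- arXiv:math/0010226 — 2 statements merged into one kernel-verified Lean document; each statement's English description precedes it below -/
import Mathlib

section
/- Let A be a commutative noetherian ring of Krull dimension d with 2 ≤ d ≤ 2n-4. The set H of E_n(A)-orbits of unimodular rows v ∈ Um_n(A) that are A¹-homotopic to (1,0,...,0) is a subgroup of the group Um_n(A)/E_n(A), and the cosets of H are exactly the A¹-homotopy equivalence classes; in particular the group structure descends to a group structure on Um_n(A)/~_{A¹}. -/
open Matrix

/-- A row is unimodular if its entries generate the unit ideal. -/
def Unim {A : Type*} [CommRing A] {ι : Type*} (v : ι → A) : Prop :=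
  Ideal.span (Set.range v) = ⊤

/-- Elementary matrices: the multiplicative closure of the set of transvections. -/
def ElemMats (ι : Type*) (A : Type*) [Fintype ι] [DecidableEq ι] [CommRing A] :
    Submonoid (Matrix ι ι A) :=
  Submonoid.closure {M | ∃ i j c, i ≠ j ∧ M = Matrix.transvection i j c}

/-- `v` and `w` are `𝔸¹`-homotopic if there is a unimodular row `z(t)` over `A[t]`
with `z(0) = v` and `z(1) = w`. -/
def A1Homotopic {A : Type*} [CommRing A] {n : ℕ} (v w : Fin n → A) : Prop :=
  ∃ z : Fin n → Polynomial A, Ideal.span (Set.range z) = ⊤ ∧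
    (∀ i, (z i).eval 0 = v i) ∧ (∀ i, (z i).eval 1 = w i)

theorem unim_iff_exists_notMem {R ι : Type*} [CommRing R] {v : ι → R} :
    Unim v ↔ ∀ Q : Ideal R, Q.IsPrime → ∃ i, v i ∉ Q := by
  refine ⟨fun h Q hQ => ?_, fun h => ?_⟩
  · by_contra! hc
    refine hQ.ne_top (top_le_iff.mp ?_)
    rw [← show Ideal.span (Set.range v) = ⊤ from h, Ideal.span_le]
    rintro _ ⟨i, rfl⟩
    exact hc i
  · by_contra hne
    obtain ⟨M, hM, hle⟩ := Ideal.exists_le_maximal _ hne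
    obtain ⟨i, hi⟩ := h M hM.isPrime
    exact hi (hle (Ideal.subset_span ⟨i, rfl⟩))

theorem Unim.map {R S ι : Type*} [CommRing R] [CommRing S] {v : ι → R} (h : Unim v)
    (f : R →+* S) : Unim (fun i => f (v i)) := by
  rw [unim_iff_exists_notMem] at h ⊢
  intro Q hQ
  exact h (Q.comap f) (hQ.comap f)

section BassStableRange

variable {R ι : Type*} [CommRing R]

/-- If `a` avoids finitely many pairwise incomparable primes, then some element of the coset
`b + aR` avoids all of them. -/
theorem exists_add_mul_notMem (T : Finset (Ideal R)) (hT : ∀ P ∈ T, P.IsPrime)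
    (hinc : ∀ P ∈ T, ∀ Q ∈ T, P ≤ Q → P = Q) (a b : R) (ha : ∀ P ∈ T, a ∉ P) :
    ∃ c, ∀ P ∈ T, b + c * a ∉ P := by
  classical
  obtain ⟨c, hc, hc'⟩ : ∃ c ∈ (T.filter (b ∉ ·)).inf id, ∀ P ∈ T.filter (b ∈ ·), c ∉ P := by
    by_contra! hcon
    have hsub : (((T.filter (b ∉ ·)).inf id : Ideal R) : Set R) ⊆
        ⋃ P ∈ (↑(T.filter (b ∈ ·)) : Set (Ideal R)), (id P : Ideal R) := by
      intro c hc
      obtain ⟨P, hP, hcP⟩ := hcon c hc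
      exact Set.mem_biUnion (Finset.mem_coe.mpr hP) hcP
    obtain ⟨P, hP, hle⟩ := (Ideal.subset_union_prime ⊥ ⊥
      fun P hP _ _ => hT P (Finset.mem_filter.mp hP).1).mp hsub
    obtain ⟨hPT, hbP⟩ := Finset.mem_filter.mp hP
    obtain ⟨Q, hQ, hQP⟩ := ((hT P hPT).inf_le').mp hle
    obtain ⟨hQT, hbQ⟩ := Finset.mem_filter.mp hQ
    exact hbQ (hinc Q hQT P hPT hQP ▸ hbP)
  refine ⟨c, fun P hP hmem => ?_⟩
  by_cases hb : b ∈ P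
  · have hca : c * a ∈ P := (P.add_mem_iff_right hb).mp hmem
    exact ((hT P hP).mem_or_mem hca).elim (hc' P (by simp [hP, hb])) (ha P hP)
  · have hcP : c ∈ P := (Finset.inf_le (f := id) (by simp [hP, hb] : P ∈ T.filter (b ∉ ·))) hc
    exact hb ((P.add_mem_iff_left (P.mul_mem_right a hcP)).mp hmem)

theorem exists_card_le_height [IsNoetherianRing R] (a : R) (b : ι → R) (s : Finset ι) :
    ∃ c : ι → R, ∀ Q : Ideal R, Q.IsPrime → a ∉ Q → (∀ i ∈ s, b i + c i * a ∈ Q) →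
      (s.card : ℕ∞) ≤ Q.height := by
  classical
  induction s using Finset.induction_on with
  | empty => exact ⟨0, by simp⟩
  | insert j s hj ih =>
    obtain ⟨c, hc⟩ := ih
    set I : Ideal R := Ideal.span ((fun i => b i + c i * a) '' s) with hI
    have hfin := I.finite_minimalPrimes_of_isNoetherianRing R
    obtain ⟨e, he⟩ := exists_add_mul_notMem (hfin.toFinset.filter (a ∉ ·))
      (fun P hP => by
        simp only [Finset.mem_filter, Set.Finite.mem_toFinset] at hP
        exact hP.1.1.1)
      (fun P hP Q hQ hPQ => by
        simp only [Finset.mem_filter, Set.Finite.mem_toFinset] at hP hQ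
        exact le_antisymm hPQ (hQ.1.2 hP.1.1 hPQ)) a (b j)
      (fun P hP => (Finset.mem_filter.mp hP).2)
    refine ⟨Function.update c j e, fun Q hQ haQ hmem => ?_⟩
    have hIQ : I ≤ Q := by
      rw [hI, Ideal.span_le]
      rintro _ ⟨i, hi, rfl⟩
      have hij : i ≠ j := fun h => hj (h ▸ hi)
      simpa [hij] using hmem i (Finset.mem_insert_of_mem hi)
    obtain ⟨P, hP, hPQ⟩ := Ideal.exists_minimalPrimes_le hIQ
    have hPp : P.IsPrime := hP.1.1
    have haP : a ∉ P := fun h => haQ (hPQ h)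
    have hjP := he P (by simp [hP, haP])
    have hjQ : b j + e * a ∈ Q := by simpa using hmem j (Finset.mem_insert_self j s)
    have hlt : P < Q := lt_of_le_of_ne hPQ fun h => hjP (h ▸ hjQ)
    have hsP := hc P hPp haP fun i hi => hP.1.2 (Ideal.subset_span ⟨i, hi, rfl⟩)
    rw [Finset.card_insert_of_notMem hj, Nat.cast_add, Nat.cast_one]
    exact (add_le_add_left hsP 1).trans (Ideal.height_add_one_le_of_lt_of_isPrime hlt)

/-- **Bass' stable range theorem**: a unimodular row of length at least `dim R + 2` can be
shortened. -/
theorem exists_sum_mul_add_mul_eq_one [IsNoetherianRing R] (a : R) (b : ι → R) (s : Finset ι)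
    (hdim : ringKrullDim R < (s.card : WithBot ℕ∞))
    (huni : ∀ Q : Ideal R, Q.IsPrime → a ∈ Q → ∃ i ∈ s, b i ∉ Q) :
    ∃ c e : ι → R, ∑ i ∈ s, e i * (b i + c i * a) = 1 := by
  classical
  obtain ⟨c, hc⟩ := exists_card_le_height a b s
  have hu : Unim (fun i : s => b i + c i * a) := by
    rw [unim_iff_exists_notMem]
    intro Q hQ
    by_contra! hmem
    by_cases ha : a ∈ Q
    · obtain ⟨i, hi, hbi⟩ := huni Q hQ ha
      exact hbi ((Q.add_mem_iff_left (Q.mul_mem_left _ ha)).mp (hmem ⟨i, hi⟩))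
    · have h1 := hc Q hQ ha fun i hi => hmem ⟨i, hi⟩
      have h2 := Ideal.height_le_ringKrullDim_of_ne_top hQ.ne_top
      exact absurd ((WithBot.coe_le_coe.mpr h1).trans h2) (not_le.mpr hdim)
  have h1 : (1 : R) ∈ Ideal.span (Set.range fun i : s => b i + c i * a) := by
    rw [show Ideal.span _ = ⊤ from hu]
    trivial
  obtain ⟨e, he⟩ := Ideal.mem_span_range_iff_exists_fun.mp h1
  refine ⟨c, fun i => if h : i ∈ s then e ⟨i, h⟩ else 0, ?_⟩
  rw [← he, ← Finset.sum_coe_sort s]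
  simp

end BassStableRange

theorem map_transvection {R S ι : Type*} [CommRing R] [CommRing S] [DecidableEq ι]
    (f : R →+* S) (i j : ι) (c : R) :
    (Matrix.transvection i j c).map f = Matrix.transvection i j (f c) := by
  ext k l
  simp [Matrix.transvection, Matrix.one_apply, Matrix.single_apply, apply_ite f]

section ElemEquiv

variable {R S ι : Type*} [CommRing R] [CommRing S] [Fintype ι] [DecidableEq ι]

/-- Two rows are elementarily equivalent if they lie in the same orbit of `E_n(R)`. -/
def ElemEquiv (v w : ι → R) : Prop :=
  ∃ ε ∈ ElemMats ι R, Matrix.vecMul v ε = w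

theorem ElemEquiv.refl (v : ι → R) : ElemEquiv v v :=
  ⟨1, one_mem _, Matrix.vecMul_one v⟩

theorem ElemEquiv.trans {u v w : ι → R} (h : ElemEquiv u v) (h' : ElemEquiv v w) :
    ElemEquiv u w := by
  obtain ⟨ε, hε, rfl⟩ := h
  obtain ⟨δ, hδ, rfl⟩ := h'
  exact ⟨ε * δ, mul_mem hε hδ, (Matrix.vecMul_vecMul _ _ _).symm⟩

theorem elemEquiv_update (v : ι → R) {i j : ι} (hij : i ≠ j) (c : R) :
    ElemEquiv v (Function.update v j (v j + c * v i)) := by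
  refine ⟨Matrix.transvection i j c, Submonoid.subset_closure ⟨i, j, c, hij, rfl⟩, ?_⟩
  ext k
  rw [Matrix.transvection, Matrix.vecMul_add, Matrix.vecMul_one, Pi.add_apply]
  by_cases hk : k = j
  · subst hk
    simp [Matrix.vecMul, dotProduct, Matrix.single_apply, mul_comm]
  · simp [Matrix.vecMul, dotProduct, hk, Ne.symm hk]

theorem elemEquiv_add_mul (v c : ι → R) (j : ι) (s : Finset ι) (hj : j ∉ s) :
    ElemEquiv v (fun i => if i ∈ s then v i + c i * v j else v i) := by
  induction s using Finset.induction_on with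
  | empty => simpa using ElemEquiv.refl v
  | insert k s hk ih =>
    rw [Finset.mem_insert, not_or] at hj
    refine (ih hj.2).trans ?_
    convert elemEquiv_update _ hj.1 (c k) using 1
    ext i
    by_cases hik : i = k
    · subst hik
      simp [hk, hj.2]
    · simp [hik]

theorem elemEquiv_update_add_sum (v c : ι → R) (j : ι) (s : Finset ι) (hj : j ∉ s) :
    ElemEquiv v (Function.update v j (v j + ∑ i ∈ s, c i * v i)) := by
  induction s using Finset.induction_on with
  | empty => simpa using ElemEquiv.refl v
  | insert k s hk ih =>
    rw [Finset.mem_insert, not_or] at hj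
    refine (ih hj.2).trans ?_
    convert elemEquiv_update _ (Ne.symm hj.1) (c k) using 1
    rw [Finset.sum_insert hk]
    ext i
    by_cases hij : i = j
    · subst hij
      simp [Ne.symm hj.1]
      ring
    · simp [hij]

theorem det_eq_one_of_mem_elemMats {ε : Matrix ι ι R} (hε : ε ∈ ElemMats ι R) : ε.det = 1 := by
  induction hε using Submonoid.closure_induction with
  | mem ε h =>
    obtain ⟨i, j, c, hij, rfl⟩ := h
    exact Matrix.det_transvection_of_ne i j hij c
  | one => exact Matrix.det_one
  | mul ε δ _ _ hε hδ => rw [Matrix.det_mul, hε, hδ, one_mul]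

theorem Unim.vecMul {v : ι → R} (hv : Unim v) {ε : Matrix ι ι R} (hε : ε ∈ ElemMats ι R) :
    Unim (Matrix.vecMul v ε) := by
  rw [unim_iff_exists_notMem] at hv ⊢
  intro Q hQ
  by_contra! hmem
  obtain ⟨i, hi⟩ := hv Q hQ
  have hinv : Matrix.vecMul (Matrix.vecMul v ε) ε⁻¹ = v := by
    rw [Matrix.vecMul_vecMul, Matrix.mul_nonsing_inv _ (by simp [det_eq_one_of_mem_elemMats hε]),
      Matrix.vecMul_one]
  refine hi ?_
  rw [← hinv]
  exact Q.sum_mem fun k _ => Q.mul_mem_right _ (hmem k)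

theorem ElemEquiv.unim {v w : ι → R} (h : ElemEquiv v w) (hv : Unim v) : Unim w := by
  obtain ⟨ε, hε, rfl⟩ := h
  exact hv.vecMul hε

theorem map_mem_elemMats (f : R →+* S) {ε : Matrix ι ι R} (hε : ε ∈ ElemMats ι R) :
    ε.map f ∈ ElemMats ι S := by
  induction hε using Submonoid.closure_induction with
  | mem ε h =>
    obtain ⟨i, j, c, hij, rfl⟩ := h
    exact Submonoid.subset_closure ⟨i, j, f c, hij, map_transvection f i j c⟩
  | one => simp
  | mul ε δ _ _ hε hδ => simpa [Matrix.map_mul] using mul_mem hε hδ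

theorem ElemEquiv.map {v w : ι → R} (h : ElemEquiv v w) (f : R →+* S) :
    ElemEquiv (fun i => f (v i)) (fun i => f (w i)) := by
  obtain ⟨ε, hε, rfl⟩ := h
  refine ⟨ε.map f, map_mem_elemMats f hε, ?_⟩
  ext i
  simp [Matrix.vecMul, dotProduct]

/-- An elementary matrix `ε` deforms along `p` to a matrix over `R[t]` which specializes to `ε`
where `p = 1` and to the identity where `p = 0`. -/
theorem exists_mem_elemMats_polynomial (p : Polynomial R) {ε : Matrix ι ι R}
    (hε : ε ∈ ElemMats ι R) :
    ∃ E ∈ ElemMats ι (Polynomial R), ∀ r : R,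
      (p.eval r = 1 → E.map (Polynomial.evalRingHom r) = ε) ∧
      (p.eval r = 0 → E.map (Polynomial.evalRingHom r) = 1) := by
  induction hε using Submonoid.closure_induction with
  | mem ε h =>
    obtain ⟨i, j, c, hij, rfl⟩ := h
    refine ⟨Matrix.transvection i j (Polynomial.C c * p),
      Submonoid.subset_closure ⟨i, j, _, hij, rfl⟩, fun r => ⟨fun h => ?_, fun h => ?_⟩⟩ <;>
    rw [map_transvection] <;> simp [h]
  | one => exact ⟨1, one_mem _, fun r => ⟨fun _ => by simp, fun _ => by simp⟩⟩
  | mul ε δ _ _ hε hδ =>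
    obtain ⟨E, hE, hEr⟩ := hε
    obtain ⟨D, hD, hDr⟩ := hδ
    refine ⟨E * D, mul_mem hE hD, fun r => ⟨fun h => ?_, fun h => ?_⟩⟩
    · rw [Matrix.map_mul, (hEr r).1 h, (hDr r).1 h]
    · rw [Matrix.map_mul, (hEr r).2 h, (hDr r).2 h, one_mul]

/-- **Mennicke–Newman lemma**: if `dim R ≤ 2n - 3`, two unimodular rows of length `n` can be
moved by elementary transformations to rows that agree outside one position, where their entries
sum to `1`. -/
theorem mennicke_newman [IsNoetherianRing R] (i₀ : ι)
    (hdim : ringKrullDim R < (2 * (Fintype.card ι - 1) : ℕ)) {v w : ι → R}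
    (hv : Unim v) (hw : Unim w) :
    ∃ (x y : R) (a : ι → R), x + y = 1 ∧ ElemEquiv v (Function.update a i₀ x) ∧
      ElemEquiv w (Function.update a i₀ y) := by
  set s : Finset ι := Finset.univ.erase i₀ with hs
  have hi₀ : i₀ ∉ s := Finset.notMem_erase _ _
  have hmem : ∀ i, i ≠ i₀ → i ∈ s := fun i hi => Finset.mem_erase.mpr ⟨hi, Finset.mem_univ i⟩
  obtain ⟨c, e, hce⟩ := exists_sum_mul_add_mul_eq_one (v i₀ * w i₀) (Sum.elim v w)
    (s.disjSum s)
    (by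
      rw [Finset.card_disjSum, hs, Finset.card_erase_of_mem (Finset.mem_univ _),
        Finset.card_univ, ← two_mul]
      exact hdim)
    (fun Q hQ ha => by
      rcases hQ.mem_or_mem ha with h | h
      · obtain ⟨i, hi⟩ := unim_iff_exists_notMem.mp hv Q hQ
        exact ⟨Sum.inl i, by simpa using hmem i (fun hii => hi (hii ▸ h)), hi⟩
      · obtain ⟨i, hi⟩ := unim_iff_exists_notMem.mp hw Q hQ
        exact ⟨Sum.inr i, by simpa using hmem i (fun hii => hi (hii ▸ h)), hi⟩)
  have hv₁ := elemEquiv_add_mul v (fun i => c (Sum.inl i) * w i₀) i₀ s hi₀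
  have hw₁ := elemEquiv_add_mul w (fun i => c (Sum.inr i) * v i₀) i₀ s hi₀
  set v₁ : ι → R := fun i => if i ∈ s then v i + c (Sum.inl i) * w i₀ * v i₀ else v i with hv₁d
  set w₁ : ι → R := fun i => if i ∈ s then w i + c (Sum.inr i) * v i₀ * w i₀ else w i with hw₁d
  have hsum : ∑ i ∈ s, e (Sum.inl i) * v₁ i + ∑ i ∈ s, e (Sum.inr i) * w₁ i = 1 := by
    rw [← hce, Finset.sum_disjSum]
    congr 1 <;> refine Finset.sum_congr rfl fun i hi => ?_
    · simp only [hv₁d, hi, if_true, Sum.elim_inl]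
      ring
    · simp only [hw₁d, hi, if_true, Sum.elim_inr]
      ring
  set k : R := 1 - v₁ i₀ - w₁ i₀ with hk
  have hv₂ := hv₁.trans (elemEquiv_update_add_sum v₁ (fun i => k * e (Sum.inl i)) i₀ s hi₀)
  have hw₂ := hw₁.trans (elemEquiv_update_add_sum w₁ (fun i => k * e (Sum.inr i)) i₀ s hi₀)
  set x : R := v₁ i₀ + ∑ i ∈ s, k * e (Sum.inl i) * v₁ i with hx
  set y : R := w₁ i₀ + ∑ i ∈ s, k * e (Sum.inr i) * w₁ i with hy
  have hxy : x + y = 1 := by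
    simp only [hx, hy, mul_assoc, ← Finset.mul_sum]
    linear_combination k * hsum + hk
  refine ⟨x, y, fun i => v₁ i * y + w₁ i * x, hxy, hv₂.trans ?_, hw₂.trans ?_⟩
  · convert elemEquiv_add_mul _ (fun i => w₁ i - v₁ i) i₀ s hi₀ using 1
    ext i
    by_cases hi : i = i₀
    · subst hi
      simp [hi₀]
    · simp only [Function.update_of_ne hi, Function.update_self, hmem i hi, if_true]
      linear_combination v₁ i * hxy
  · convert elemEquiv_add_mul _ (fun i => v₁ i - w₁ i) i₀ s hi₀ using 1
    ext i
    by_cases hi : i = i₀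
    · subst hi
      simp [hi₀]
    · simp only [Function.update_of_ne hi, Function.update_self, hmem i hi, if_true]
      linear_combination w₁ i * hxy

end ElemEquiv

/-- Homotopies can be corrected at both ends by elementary matrices. -/
theorem A1Homotopic.of_elemEquiv {A : Type*} [CommRing A] {n : ℕ} {v v' w w' : Fin n → A}
    (h : A1Homotopic v w) (hv : ElemEquiv v v') (hw : ElemEquiv w w') : A1Homotopic v' w' := by
  obtain ⟨z, hz, hz0, hz1⟩ := h
  obtain ⟨ε, hε, rfl⟩ := hv
  obtain ⟨δ, hδ, rfl⟩ := hw
  obtain ⟨E, hE, hEr⟩ := exists_mem_elemMats_polynomial (1 - Polynomial.X) hε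
  obtain ⟨D, hD, hDr⟩ := exists_mem_elemMats_polynomial Polynomial.X hδ
  have heval : ∀ (r : A) (i : Fin n), (Matrix.vecMul z (E * D) i).eval r =
      Matrix.vecMul (fun i => (z i).eval r) (E.map (Polynomial.evalRingHom r) *
        D.map (Polynomial.evalRingHom r)) i := by
    intro r i
    rw [← Matrix.map_mul]
    simp [Matrix.vecMul, dotProduct, Polynomial.eval_finsetSum]
  refine ⟨Matrix.vecMul z (E * D), Unim.vecMul hz (mul_mem hE hD), fun i => ?_, fun i => ?_⟩
  · rw [heval, (hEr 0).1 (by simp), (hDr 0).2 (by simp), mul_one, funext hz0]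
  · rw [heval, (hEr 1).2 (by simp), (hDr 1).1 (by simp), one_mul, funext hz1]

theorem A1Homotopic.symm {A : Type*} [CommRing A] {n : ℕ} {v w : Fin n → A}
    (h : A1Homotopic v w) : A1Homotopic w v := by
  obtain ⟨z, hz, hz0, hz1⟩ := h
  refine ⟨fun i => (z i).comp (1 - Polynomial.X),
    Unim.map hz (Polynomial.compRingHom (1 - Polynomial.X)), fun i => ?_, fun i => ?_⟩
  · simpa [Polynomial.eval_comp] using hz1 i
  · simpa [Polynomial.eval_comp] using hz0 i

theorem Unim.a1Homotopic_refl {A : Type*} [CommRing A] {n : ℕ} {v : Fin n → A}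
    (hv : Unim v) : A1Homotopic v v :=
  ⟨fun i => Polynomial.C (v i), hv.map Polynomial.C, by simp, by simp⟩

/-- let `A` be commutative noetherian of Krull dimension `d` with
`2 ≤ d ≤ 2n - 4`, and let `wms` realize van der Kallen's group structure on
`Um_n(A)/E_n(A)` (a bijection from the orbit set to an abelian group `G`, satisfying
MS1 and MS3).  The orbits of rows `𝔸¹`-homotopic to `(1, 0, …, 0)` form a subgroup `H`
of `G ≅ Um_n(A)/E_n(A)`, whose cosets are exactly the `𝔸¹`-homotopy classes; in
particular the group structure descends to `Um_n(A)/∼_{𝔸¹}`. -/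
theorem stmt11 {A G : Type*} [CommRing A] [IsNoetherianRing A] [CommGroup G] {d n : ℕ}
    (hd : ringKrullDim A ≤ d) (hd2 : 2 ≤ d) (hdn : d + 4 ≤ 2 * n)
    (wms : (Fin n → A) → G)
    (hsurj : ∀ g : G, ∃ v : Fin n → A, Unim v ∧ wms v = g)
    (horbit : ∀ v w : Fin n → A, Unim v → Unim w →
      (wms v = wms w ↔ ∃ ε ∈ ElemMats (Fin n) A, Matrix.vecMul v ε = w))
    (hMS1 : ∀ v : Fin n → A, Unim v → ∀ ε ∈ ElemMats (Fin n) A,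
      wms (Matrix.vecMul v ε) = wms v)
    (hMS3 : ∀ (x y : A) (a : Fin n → A), x + y = 1 →
      Unim (Function.update a (⟨0, by omega⟩ : Fin n) x) →
      Unim (Function.update a (⟨0, by omega⟩ : Fin n) y) →
      wms (Function.update a (⟨0, by omega⟩ : Fin n) (x * y)) =
        wms (Function.update a (⟨0, by omega⟩ : Fin n) x) *
        wms (Function.update a (⟨0, by omega⟩ : Fin n) y)) :
    ∃ H : Subgroup G,
      (∀ g : G, g ∈ H ↔ ∃ v : Fin n → A, Unim v ∧
        A1Homotopic v (Pi.single (⟨0, by omega⟩ : Fin n) 1) ∧ wms v = g) ∧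
      (∀ v w : Fin n → A, Unim v → Unim w →
        (A1Homotopic v w ↔ (wms w)⁻¹ * wms v ∈ H)) := by
  set i₀ : Fin n := ⟨0, by omega⟩ with hi₀
  have hstep : ∀ {v w : Fin n → A}, Unim v → ElemEquiv v w → wms v = wms w := by
    rintro v w hv ⟨ε, hε, rfl⟩
    exact (hMS1 v hv ε hε).symm
  have he₁ : Unim (Pi.single i₀ 1 : Fin n → A) :=
    unim_iff_exists_notMem.mpr fun Q hQ => ⟨i₀, by
      simpa using fun h => hQ.ne_top ((Ideal.eq_top_iff_one Q).mpr h)⟩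
  have hone : wms (Pi.single i₀ 1) = 1 := by
    set i₁ : Fin n := ⟨1, by omega⟩ with hi₁
    have h01 : i₁ ≠ i₀ := by simp [hi₀, hi₁]
    have hu : ∀ x : A, Unim (Function.update (Pi.single i₁ 1) i₀ x : Fin n → A) := fun x =>
      unim_iff_exists_notMem.mpr fun Q hQ => ⟨i₁, by
        simpa [h01] using fun h => hQ.ne_top ((Ideal.eq_top_iff_one Q).mpr h)⟩
    have h := hMS3 1 0 (Pi.single i₁ 1) (by simp) (hu 1) (hu 0)
    rw [mul_zero, right_eq_mul] at h
    rw [← h]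
    refine hstep he₁ ?_
    convert elemEquiv_update (Pi.single i₀ 1 : Fin n → A) h01.symm 1 using 1
    ext i
    by_cases hi : i = i₀
    · subst hi
      simp [h01.symm]
    · by_cases hi' : i = i₁
      · subst hi'
        simp [h01]
      · simp [hi, hi']
  -- The classes of the two ends of a homotopy; this is a symmetric submonoid of `G × G`.
  let E : G → G → Prop := fun g h => ∃ v w : Fin n → A, Unim v ∧ Unim w ∧ A1Homotopic v w ∧
    wms v = g ∧ wms w = h
  have hE : ∀ v w : Fin n → A, Unim v → Unim w → (E (wms v) (wms w) ↔ A1Homotopic v w) := by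
    refine fun v w hv hw => ⟨?_, fun h => ⟨v, w, hv, hw, h, rfl, rfl⟩⟩
    rintro ⟨v', w', hv', hw', h, h1, h2⟩
    exact h.of_elemEquiv ((horbit _ _ hv' hv).mp h1) ((horbit _ _ hw' hw).mp h2)
  have hErefl : ∀ g, E g g := fun g => by
    obtain ⟨v, hv, rfl⟩ := hsurj g
    exact (hE v v hv hv).mpr hv.a1Homotopic_refl
  have hEsymm : ∀ {g h}, E g h → E h g := by
    rintro g h ⟨v, w, hv, hw, hvw, rfl, rfl⟩
    exact (hE w v hw hv).mpr hvw.symm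
  have hdim : ringKrullDim (Polynomial A) < (2 * (Fintype.card (Fin n) - 1) : ℕ) := by
    rw [Polynomial.ringKrullDim_of_isNoetherianRing, Fintype.card_fin]
    calc ringKrullDim A + 1 ≤ (d : WithBot ℕ∞) + 1 := by gcongr
      _ = ((d + 1 : ℕ) : WithBot ℕ∞) := by push_cast; rfl
      _ < (2 * (n - 1) : ℕ) := by
        exact_mod_cast (by omega : d + 1 < 2 * (n - 1))
  have hEmul : ∀ {g h g' h'}, E g h → E g' h' → E (g * g') (h * h') := by
    rintro _ _ _ _ ⟨v, w, hv, hw, ⟨z, hz, hz0, hz1⟩, rfl, rfl⟩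
      ⟨v', w', hv', hw', ⟨z', hz', hz0', hz1'⟩, rfl, rfl⟩
    obtain ⟨x, y, a, hxy, hzx, hzy⟩ := mennicke_newman i₀ hdim hz hz'
    have hux := hzx.unim hz
    have huy := hzy.unim hz'
    have huxy : Unim (Function.update a i₀ (x * y)) := by
      rw [unim_iff_exists_notMem] at hux huy ⊢
      intro Q hQ
      by_contra! hmem
      have hother : ∀ i, i ≠ i₀ → a i ∈ Q := fun i hi => by simpa [hi] using hmem i
      rcases hQ.mem_or_mem (show x * y ∈ Q by simpa using hmem i₀) with h | h
      · obtain ⟨i, hi⟩ := hux Q hQ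
        rcases eq_or_ne i i₀ with rfl | hne
        · exact hi (by simpa using h)
        · exact hi (by simpa [hne] using hother i hne)
      · obtain ⟨i, hi⟩ := huy Q hQ
        rcases eq_or_ne i i₀ with rfl | hne
        · exact hi (by simpa using h)
        · exact hi (by simpa [hne] using hother i hne)
    have hupd : ∀ (r : A) (p : Polynomial A),
        (fun i => Polynomial.evalRingHom r (Function.update a i₀ p i)) =
          Function.update (fun i => (a i).eval r) i₀ (p.eval r) := fun r p => by
      ext i
      rcases eq_or_ne i i₀ with rfl | hne
      · simp
      · simp [hne]
    have hspec : ∀ r : A, wms (fun i => (Function.update a i₀ (x * y) i).eval r) =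
        wms (fun i => (z i).eval r) * wms (fun i => (z' i).eval r) := by
      intro r
      have h1 := hstep (Unim.map hz (Polynomial.evalRingHom r))
        (hzx.map (Polynomial.evalRingHom r))
      have h2 := hstep (Unim.map hz' (Polynomial.evalRingHom r))
        (hzy.map (Polynomial.evalRingHom r))
      have h3 := hux.map (Polynomial.evalRingHom r)
      have h4 := huy.map (Polynomial.evalRingHom r)
      have h5 := hupd r (x * y)
      rw [hupd] at h1 h2 h3 h4
      simp only [Polynomial.coe_evalRingHom] at h1 h2 h5
      rw [h1, h2, h5, Polynomial.eval_mul]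
      exact hMS3 _ _ _ (by rw [← Polynomial.eval_add, hxy, Polynomial.eval_one]) h3 h4
    refine ⟨_, _, huxy.map (Polynomial.evalRingHom 0), huxy.map (Polynomial.evalRingHom 1),
      ⟨_, huxy, fun _ => rfl, fun _ => rfl⟩, ?_, ?_⟩
    · simpa only [Polynomial.coe_evalRingHom, hz0, hz0'] using hspec 0
    · simpa only [Polynomial.coe_evalRingHom, hz1, hz1'] using hspec 1
  refine ⟨{ carrier := {g | E g 1}
            one_mem' := hErefl 1
            mul_mem' := fun {g h} hg hh => by simpa using hEmul hg hh
            inv_mem' := fun {g} hg => hEsymm (by simpa using hEmul hg (hErefl g⁻¹)) },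
    fun g => ?_, fun v w hv hw => ?_⟩
  · change E g 1 ↔ _
    constructor
    · intro hg
      obtain ⟨v, hv, rfl⟩ := hsurj g
      exact ⟨v, hv, (hE v _ hv he₁).mp (by rwa [hone]), rfl⟩
    · rintro ⟨v, hv, h, rfl⟩
      rw [← hone]
      exact (hE v _ hv he₁).mpr h
  · change _ ↔ E _ 1
    rw [← hE v w hv hw]
    refine ⟨fun h => by simpa using hEmul (hErefl (wms w)⁻¹) h, fun h => ?_⟩
    simpa using hEmul (hErefl (wms w)) h
end

section
/- Let A be a commutative Banach algebra (e.g. continuous real-valued functions on a finite CW complex), m < n, n ≥ 3, M ∈ Um_{m,n}(A), and T ∈ GL_m(A) sufficiently close to the identity. Then TM and M(T ⊥ I_{n-m}) lie in the same E_n(A)-orbit. -/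
open Matrix

open Filter Topology

section Elementary

variable {ι κ A : Type*} [Fintype ι] [DecidableEq ι] [Fintype κ] [DecidableEq κ] [CommRing A]

theorem transvection_mem_elemMats {i j : ι} (h : i ≠ j) (c : A) :
    transvection i j c ∈ ElemMats ι A :=
  Submonoid.subset_closure ⟨i, j, c, h, rfl⟩

theorem fromBlocks_upper_mem_elemMats (B : Matrix ι κ A) :
    fromBlocks 1 B 0 1 ∈ ElemMats (ι ⊕ κ) A := by
  induction B using Matrix.induction_on' with
  | h_zero => simp
  | h_add p q hp hq =>
    have h := mul_mem hp hq
    rw [fromBlocks_multiply] at h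
    simpa [add_comm] using h
  | h_std_basis i j x =>
    have h : fromBlocks 1 (single i j x) 0 1 = transvection (Sum.inl i : ι ⊕ κ) (Sum.inr j) x := by
      ext (a | a) (b | b) <;> simp [transvection, single, one_apply]
    rw [h]
    exact transvection_mem_elemMats Sum.inl_ne_inr x

theorem fromBlocks_lower_mem_elemMats (C : Matrix κ ι A) :
    fromBlocks 1 0 C 1 ∈ ElemMats (ι ⊕ κ) A := by
  induction C using Matrix.induction_on' with
  | h_zero => simp
  | h_add p q hp hq =>
    have h := mul_mem hp hq
    rw [fromBlocks_multiply] at h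
    simpa using h
  | h_std_basis i j x =>
    have h : fromBlocks 1 0 (single i j x) 1 = transvection (Sum.inr i : ι ⊕ κ) (Sum.inl j) x := by
      ext (a | a) (b | b) <;> simp [transvection, single, one_apply]
    rw [h]
    exact transvection_mem_elemMats Sum.inr_ne_inl x

theorem fromBlocks_one_mem_elemMats {X : Matrix ι ι A} (hX : X ∈ ElemMats ι A) :
    fromBlocks X 0 0 (1 : Matrix κ κ A) ∈ ElemMats (ι ⊕ κ) A := by
  induction hX using Submonoid.closure_induction with
  | mem x hx =>
    obtain ⟨i, j, c, hij, rfl⟩ := hx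
    have h : fromBlocks (transvection i j c) 0 0 1 =
        transvection (Sum.inl i : ι ⊕ κ) (Sum.inl j) c := by
      ext (a | a) (b | b) <;> simp [transvection, single, one_apply]
    rw [h]
    exact transvection_mem_elemMats (by simpa using hij) c
  | one => simp
  | mul x y _ _ hx hy => simpa [fromBlocks_multiply] using mul_mem hx hy

theorem submatrix_mem_elemMats (e : κ ≃ ι) {X : Matrix ι ι A} (hX : X ∈ ElemMats ι A) :
    X.submatrix e e ∈ ElemMats κ A := by
  induction hX using Submonoid.closure_induction with
  | mem x hx =>
    obtain ⟨i, j, c, hij, rfl⟩ := hx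
    have h : (transvection i j c).submatrix e e = transvection (e.symm i) (e.symm j) c := by
      ext a b
      simp [transvection, single, one_apply, Equiv.symm_apply_eq]
    rw [h]
    exact transvection_mem_elemMats (by simpa using hij) c
  | one => simp
  | mul x y _ _ hx hy =>
    rw [← submatrix_mul_equiv x y e e e]
    exact mul_mem hx hy

/-- Whitehead's lemma for a unit and its inverse placed at two distinct diagonal positions. -/
theorem one_add_single_add_single_mem_elemMats {i j : ι} (h : i ≠ j) (u : Aˣ) :
    1 + single i i ((u : A) - 1) + single j j ((↑u⁻¹ : A) - 1) ∈ ElemMats ι A := by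
  have key : transvection i j (u : A) * transvection j i (-(↑u⁻¹ : A)) * transvection i j (u : A) *
      (transvection i j (-1) * transvection j i 1 * transvection i j (-1)) =
      1 + single i i ((u : A) - 1) + single j j ((↑u⁻¹ : A) - 1) := by
    have weyl (v : Aˣ) : transvection i j (v : A) * transvection j i (-(↑v⁻¹ : A)) *
        transvection i j (v : A) = 1 - single i i 1 - single j j 1 + single i j (v : A)
          - single j i (↑v⁻¹ : A) := by
      simp only [transvection, mul_add, add_mul, mul_one, one_mul, single_mul_single_same,
        single_mul_single_of_ne _ _ _ _ h.symm,
        mul_neg, neg_mul, Units.mul_inv, Units.inv_mul, add_zero, ← single_neg]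
      abel
    have h1 := weyl (-1)
    simp only [Units.val_neg, Units.val_one, inv_neg, inv_one, neg_neg] at h1
    rw [weyl, h1]
    simp only [mul_add, add_mul, mul_one, one_mul, single_mul_single_same,
        single_mul_single_of_ne _ _ _ _ h, single_mul_single_of_ne _ _ _ _ h.symm,
        mul_neg, neg_mul, ← single_neg, sub_eq_add_neg, single_add]
    abel
  rw [← key]
  have h' := h.symm
  exact mul_mem (mul_mem (mul_mem (transvection_mem_elemMats h _) (transvection_mem_elemMats h' _))
    (transvection_mem_elemMats h _)) (mul_mem (mul_mem (transvection_mem_elemMats h _)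
    (transvection_mem_elemMats h' _)) (transvection_mem_elemMats h _))

theorem diagonal_mulSingle_mul_mulSingle_inv_mem_elemMats (i j : ι) (u : Aˣ) :
    diagonal (fun l => ((Pi.mulSingle i u * Pi.mulSingle j u⁻¹ : ι → Aˣ) l : A)) ∈
      ElemMats ι A := by
  rcases eq_or_ne i j with rfl | h
  · rw [← Pi.mulSingle_mul]
    simp
  · convert one_add_single_add_single_mem_elemMats h u using 1
    ext a b
    rcases eq_or_ne a b with rfl | hab
    · rcases eq_or_ne a i with rfl | hi
      · simp [single, h, h.symm]
      · rcases eq_or_ne a j with rfl | hj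
        · simp [single, h]
        · simp [single, hi, hj, hi.symm, hj.symm]
    · have hi : ¬ (i = a ∧ i = b) := fun h => hab (h.1.symm.trans h.2)
      have hj : ¬ (j = a ∧ j = b) := fun h => hab (h.1.symm.trans h.2)
      simp [single, hab, hi, hj]

theorem diagonal_mem_elemMats {d : ι → Aˣ} (hd : ∏ i, d i = 1) :
    diagonal (fun i => (d i : A)) ∈ ElemMats ι A := by
  rcases isEmpty_or_nonempty ι with _ | ⟨⟨j⟩⟩
  · rw [Subsingleton.elim (diagonal _) (1 : Matrix ι ι A)]
    exact one_mem _
  have hprod : d = ∏ i, (Pi.mulSingle i (d i) * Pi.mulSingle j (d i)⁻¹ : ι → Aˣ) := by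
    rw [Finset.prod_mul_distrib, Finset.univ_prod_mulSingle]
    have h : ∏ i, (Pi.mulSingle j (d i)⁻¹ : ι → Aˣ) = Pi.mulSingle j (∏ i, (d i)⁻¹) :=
      (map_prod (MonoidHom.mulSingle (fun _ : ι => Aˣ) j) _ _).symm
    rw [h, Finset.prod_inv_distrib, hd, inv_one, Pi.mulSingle_one, mul_one]
  let S : Submonoid (ι → Aˣ) := (ElemMats ι A).comap
    ((diagonalRingHom ι A).toMonoidHom.comp ((Units.coeHom A).compLeft ι))
  have hS : ∏ i, (Pi.mulSingle i (d i) * Pi.mulSingle j (d i)⁻¹ : ι → Aˣ) ∈ S :=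
    prod_mem fun i _ => diagonal_mulSingle_mul_mulSingle_inv_mem_elemMats i j (d i)
  rw [← hprod] at hS
  exact hS

variable (ι A) in
/-- Matrices that elementary row and column operations bring to an invertible diagonal form. -/
def ElemDiagonalizable : Set (Matrix ι ι A) :=
  {X | ∃ e ∈ ElemMats ι A, ∃ d : ι → Aˣ, ∃ f ∈ ElemMats ι A,
    X = e * diagonal (fun i => (d i : A)) * f}

theorem det_eq_one_of_mem_elemMats_s14 {X : Matrix ι ι A} (hX : X ∈ ElemMats ι A) : X.det = 1 := by
  induction hX using Submonoid.closure_induction with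
  | mem x hx =>
    obtain ⟨i, j, c, hij, rfl⟩ := hx
    exact det_transvection_of_ne i j hij c
  | one => exact det_one
  | mul x y _ _ hx hy => rw [det_mul, hx, hy, one_mul]

theorem ElemDiagonalizable.mem_elemMats {X : Matrix ι ι A} (hX : X ∈ ElemDiagonalizable ι A)
    (hdet : X.det = 1) : X ∈ ElemMats ι A := by
  obtain ⟨e, he, d, f, hf, rfl⟩ := hX
  rw [det_mul, det_mul, det_eq_one_of_mem_elemMats_s14 he, det_eq_one_of_mem_elemMats_s14 hf,
    det_diagonal, one_mul, mul_one] at hdet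
  exact mul_mem (mul_mem he (diagonal_mem_elemMats (Units.ext (by simpa using hdet)))) hf

theorem ElemDiagonalizable.isUnit_det {X : Matrix ι ι A} (hX : X ∈ ElemDiagonalizable ι A) :
    IsUnit X.det := by
  obtain ⟨e, he, d, f, hf, rfl⟩ := hX
  rw [det_mul, det_mul, det_eq_one_of_mem_elemMats_s14 he, det_eq_one_of_mem_elemMats_s14 hf,
    det_diagonal, one_mul, mul_one]
  exact ⟨∏ i, d i, by simp⟩

theorem ElemDiagonalizable.submatrix (e : κ ≃ ι) {X : Matrix ι ι A}
    (hX : X ∈ ElemDiagonalizable ι A) : X.submatrix e e ∈ ElemDiagonalizable κ A := by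
  obtain ⟨a, ha, d, b, hb, rfl⟩ := hX
  refine ⟨_, submatrix_mem_elemMats e ha, d ∘ e, _, submatrix_mem_elemMats e hb, ?_⟩
  rw [← submatrix_mul_equiv _ _ e e e, ← submatrix_mul_equiv _ _ e e e, submatrix_diagonal_equiv]
  rfl

theorem ElemDiagonalizable.of_toBlocks₁₁ {X : Matrix (ι ⊕ Unit) (ι ⊕ Unit) A}
    (hX : X.toBlocks₁₁ ∈ ElemDiagonalizable ι A) (hdet : IsUnit X.det) :
    X ∈ ElemDiagonalizable (ι ⊕ Unit) A := by
  let := invertibleOfIsUnitDet _ (ElemDiagonalizable.isUnit_det hX)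
  have hfac := fromBlocks_eq_of_invertible₁₁ X.toBlocks₁₁ X.toBlocks₁₂ X.toBlocks₂₁ X.toBlocks₂₂
  set S := X.toBlocks₂₂ - X.toBlocks₂₁ * ⅟X.toBlocks₁₁ * X.toBlocks₁₂
  rw [fromBlocks_toBlocks] at hfac
  have hS : IsUnit (S () ()) := by
    rw [hfac] at hdet
    simp only [det_mul, det_fromBlocks_zero₁₂, det_fromBlocks_zero₂₁, det_one, one_mul,
      mul_one] at hdet
    rw [det_unique S] at hdet
    exact isUnit_of_mul_isUnit_right hdet
  obtain ⟨s, hs⟩ := hS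
  obtain ⟨e, he, d, f, hf, hX⟩ := hX
  have hmid : fromBlocks X.toBlocks₁₁ 0 0 S = fromBlocks e 0 0 1 *
      diagonal (fun i => ((Sum.elim d (fun _ => s) i : Aˣ) : A)) * fromBlocks f 0 0 1 := by
    have hdiag : diagonal (fun i => ((Sum.elim d (fun _ : Unit => s) i : Aˣ) : A)) =
        fromBlocks (diagonal fun i => (d i : A)) 0 0 S := by
      ext (a | a) (b | b) <;> simp [diagonal_apply, hs]
    rw [hdiag, hX]
    simp [fromBlocks_multiply]
  rw [hmid] at hfac
  refine ⟨_, mul_mem (fromBlocks_lower_mem_elemMats (X.toBlocks₂₁ * ⅟X.toBlocks₁₁))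
    (fromBlocks_one_mem_elemMats he), Sum.elim d (fun _ => s), _, mul_mem
    (fromBlocks_one_mem_elemMats hf)
    (fromBlocks_upper_mem_elemMats (⅟X.toBlocks₁₁ * X.toBlocks₁₂)), hfac.trans ?_⟩
  simp only [Matrix.mul_assoc]

end Elementary

section Topology

variable {A : Type*} [NormedCommRing A] [CompleteSpace A]

theorem eventually_isUnit_det {ι : Type*} [Fintype ι] [DecidableEq ι] :
    ∀ᶠ X in 𝓝 (1 : Matrix ι ι A), IsUnit X.det := by
  have hdet : Continuous fun X : Matrix ι ι A => X.det := continuous_id.matrix_det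
  exact hdet.continuousAt.eventually (Units.isOpen.mem_nhds (by simp))

theorem eventually_elemDiagonalizable_fin (n : ℕ) :
    ∀ᶠ X in 𝓝 (1 : Matrix (Fin n) (Fin n) A), X ∈ ElemDiagonalizable (Fin n) A := by
  induction n with
  | zero =>
    refine Eventually.of_forall fun X => ⟨1, one_mem _, 1, 1, one_mem _, Subsingleton.elim _ _⟩
  | succ n ih =>
    let e : Fin n ⊕ Unit ≃ Fin (n + 1) := Fintype.equivOfCardEq (by simp)
    have hcont : Continuous fun X : Matrix (Fin (n + 1)) (Fin (n + 1)) A =>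
        (X.submatrix e e).toBlocks₁₁ :=
      continuous_matrix fun i j => continuous_id.matrix_elem _ _
    have hone : ((1 : Matrix (Fin (n + 1)) (Fin (n + 1)) A).submatrix e e).toBlocks₁₁ = 1 := by
      rw [submatrix_one_equiv, ← fromBlocks_one, toBlocks_fromBlocks₁₁]
    have hblock := hcont.tendsto 1
    rw [hone] at hblock
    filter_upwards [hblock.eventually ih, eventually_isUnit_det] with X hX hdet
    have h := ElemDiagonalizable.submatrix e.symm
      (ElemDiagonalizable.of_toBlocks₁₁ hX (by rwa [det_submatrix_equiv_self]))
    simpa using h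

/-- Matrices of determinant one close to the identity are elementary. -/
theorem eventually_mem_elemMats {ι : Type*} [Fintype ι] [DecidableEq ι] :
    ∀ᶠ X in 𝓝 (1 : Matrix ι ι A), X.det = 1 → X ∈ ElemMats ι A := by
  let e := Fintype.equivFin ι
  have hcont : Continuous fun X : Matrix ι ι A => X.submatrix e.symm e.symm :=
    continuous_id.matrix_submatrix _ _
  have htend := hcont.tendsto 1
  rw [submatrix_one_equiv] at htend
  filter_upwards [htend.eventually (eventually_elemDiagonalizable_fin _)] with X hX hdet
  have h := ElemDiagonalizable.submatrix e hX
  rw [submatrix_submatrix, Equiv.symm_comp_self, submatrix_id_id] at h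
  exact ElemDiagonalizable.mem_elemMats h hdet

theorem continuousAt_matrix_inv_one {ι : Type*} [Fintype ι] [DecidableEq ι] :
    ContinuousAt (fun X : Matrix ι ι A => X⁻¹) 1 := by
  have hdet : Continuous fun X : Matrix ι ι A => X.det := continuous_id.matrix_det
  have hadj : Continuous fun X : Matrix ι ι A => X.adjugate := continuous_id.matrix_adjugate
  have hinv : ContinuousAt (Ring.inverse : A → A) (1 : Matrix ι ι A).det := by
    simpa using NormedRing.inverse_continuousAt (1 : Aˣ)
  simp only [inv_def]
  exact (hinv.comp (f := fun X : Matrix ι ι A => X.det) hdet.continuousAt).smul hadj.continuousAt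

end Topology

section Orbit

variable {ι κ A : Type*} [Fintype ι] [DecidableEq ι] [Fintype κ] [DecidableEq κ] [CommRing A]

/-- The matrix carrying `M * (T ⊥ 1)` to `T * M` when `N` is a right inverse of `M`. -/
noncomputable def orbitCorrection (M : Matrix ι (ι ⊕ κ) A) (N : Matrix (ι ⊕ κ) ι A)
    (T : Matrix ι ι A) : Matrix (ι ⊕ κ) (ι ⊕ κ) A :=
  fromBlocks T⁻¹ 0 0 1 * (1 + N * ((T - 1) * M))

theorem mul_eq_mul_orbitCorrection {M : Matrix ι (ι ⊕ κ) A} {N : Matrix (ι ⊕ κ) ι A}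
    (hMN : M * N = 1) {T : Matrix ι ι A} (hT : IsUnit T.det) :
    T * M = M * fromBlocks T 0 0 (1 : Matrix κ κ A) * orbitCorrection M N T := by
  have hD : fromBlocks T 0 0 (1 : Matrix κ κ A) * fromBlocks T⁻¹ 0 0 1 = 1 := by
    simp [fromBlocks_multiply, mul_nonsing_inv T hT]
  rw [orbitCorrection, Matrix.mul_assoc, ← Matrix.mul_assoc (fromBlocks T 0 0 1), hD,
    Matrix.one_mul, Matrix.mul_add, Matrix.mul_one, ← Matrix.mul_assoc, hMN, Matrix.one_mul,
    Matrix.sub_mul, Matrix.one_mul, add_sub_cancel]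

theorem det_orbitCorrection {M : Matrix ι (ι ⊕ κ) A} {N : Matrix (ι ⊕ κ) ι A}
    (hMN : M * N = 1) {T : Matrix ι ι A} (hT : IsUnit T.det) :
    (orbitCorrection M N T).det = 1 := by
  rw [orbitCorrection, det_mul, det_fromBlocks_zero₂₁, det_one, mul_one, det_one_add_mul_comm,
    Matrix.mul_assoc, hMN, Matrix.mul_one, add_sub_cancel, ← det_mul, nonsing_inv_mul T hT,
    det_one]

end Orbit

theorem tendsto_orbitCorrection {ι κ A : Type*} [Fintype ι] [DecidableEq ι] [Fintype κ]
    [DecidableEq κ] [NormedCommRing A] [CompleteSpace A] (M : Matrix ι (ι ⊕ κ) A)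
    (N : Matrix (ι ⊕ κ) ι A) : Tendsto (orbitCorrection M N) (𝓝 1) (𝓝 1) := by
  have hblock : Continuous fun X : Matrix ι ι A => fromBlocks X 0 0 (1 : Matrix κ κ A) :=
    continuous_id.matrix_fromBlocks continuous_const continuous_const continuous_const
  have hfactor : Continuous fun T : Matrix ι ι A => 1 + N * ((T - 1) * M) :=
    continuous_const.add (continuous_const.matrix_mul
      ((continuous_id.sub continuous_const).matrix_mul continuous_const))
  have h : ContinuousAt (orbitCorrection M N) 1 :=
    (hblock.continuousAt.comp (f := fun X : Matrix ι ι A => X⁻¹)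
      continuousAt_matrix_inv_one).mul hfactor.continuousAt
  have hone : orbitCorrection M N 1 = 1 := by simp [orbitCorrection]
  simpa only [ContinuousAt, hone] using h

attribute [local instance] Matrix.normedAddCommGroup in
theorem exists_entrywise_of_eventually_nhds {ι κ A : Type*} [Fintype ι] [Fintype κ]
    [NormedCommRing A] {Y : Matrix ι κ A} {p : Matrix ι κ A → Prop} (h : ∀ᶠ X in 𝓝 Y, p X) :
    ∃ δ > (0 : ℝ), ∀ X : Matrix ι κ A, (∀ i j, ‖X i j - Y i j‖ < δ) → p X := by
  obtain ⟨δ, hδ, hp⟩ := Metric.eventually_nhds_iff.1 h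
  refine ⟨δ, hδ, fun X hX => hp ?_⟩
  rw [dist_eq_norm, Matrix.norm_lt_iff hδ]
  exact hX

/-- over a commutative Banach algebra `A`, for `M ∈ Um_{m,n}(A)`
(columns indexed by `Fin m ⊕ Fin k`, `n = m + k > m`, `n ≥ 3`) and `T ∈ GL_m(A)`
sufficiently close to the identity, `TM` and `M (T ⊥ I_{n-m})` lie in the same
`E_n(A)`-orbit. -/
theorem stmt14 {A : Type*} [NormedCommRing A] [CompleteSpace A] {m k : ℕ}
    (hk : 0 < k) (hn : 3 ≤ m + k)
    (M : Matrix (Fin m) (Fin m ⊕ Fin k) A)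
    (hM : ∃ N : Matrix (Fin m ⊕ Fin k) (Fin m) A, M * N = 1) :
    ∃ δ > (0 : ℝ), ∀ T : Matrix (Fin m) (Fin m) A, IsUnit T →
      (∀ i j, ‖T i j - (1 : Matrix (Fin m) (Fin m) A) i j‖ < δ) →
      ∃ ε ∈ ElemMats (Fin m ⊕ Fin k) A,
        T * M = M * Matrix.fromBlocks T 0 0 (1 : Matrix (Fin k) (Fin k) A) * ε := by
  obtain ⟨N, hMN⟩ := hM
  obtain ⟨δ, hδ, h⟩ := exists_entrywise_of_eventually_nhds
    ((tendsto_orbitCorrection M N).eventually eventually_mem_elemMats)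
  refine ⟨δ, hδ, fun T hT hclose => ?_⟩
  have hdet : IsUnit T.det := (isUnit_iff_isUnit_det T).1 hT
  exact ⟨orbitCorrection M N T, h T hclose (det_orbitCorrection hMN hdet),
    mul_eq_mul_orbitCorrection hMN hdet⟩
end
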